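/- arXiv:2409.12914 — 2 statements merged into one kernel-verified Lean document; each statement's English description precedes it below -/
import Mathlib

section
/- Suppose R s a ≥ 0 for all s, a, and that for each state s there exists an action a with c s a ≤ b. Let π_c be a feasible policy that maximizes J(R, ·) over all feasible policies. Then π_c maximizes the constrained-reward value over ALL policies: for every policy π (feasible or not), J(R_c, π) ≤ J(R_c, π_c), where R_c s a = R s a if c s a ≤ b and R_c s a = 0 otherwise. -/
open Finset
open scoped Classical

/-- A (stochastic) policy on states `S` and actions `A`: nonnegative and sums to 1 in each state. -/
def IsPolicy {S A : Type*} [Fintype A] (π : S → A → ℝ) : Prop :=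
  (∀ s a, 0 ≤ π s a) ∧ ∀ s, ∑ a, π s a = 1

/-- The value of a policy `π` under reward function `R`. -/
noncomputable def J {S A : Type*} [Fintype S] [Fintype A]
    (R : S → A → ℝ) (π : S → A → ℝ) : ℝ :=
  ∑ s, ∑ a, π s a * R s a

/-- A policy is feasible if it only puts positive probability on actions with cost at most `b`. -/
def Feasible {S A : Type*} (c : S → A → ℝ) (b : ℝ) (π : S → A → ℝ) : Prop :=
  ∀ s a, 0 < π s a → c s a ≤ b

/-- with nonnegative rewards and a constraint-satisfying action in each
state, a feasible policy optimal among feasible policies for `R` is optimal among ALL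
policies for the constrained reward `R_c`. -/
theorem constrained_optimum_maximizes_constrained_reward
    {S A : Type*} [Fintype S] [Fintype A] [Nonempty S] [Nonempty A]
    (R c : S → A → ℝ) (b : ℝ)
    (hR : ∀ s a, 0 ≤ R s a)
    (hfeas : ∀ s, ∃ a, c s a ≤ b)
    (πc : S → A → ℝ)
    (hπc : IsPolicy πc) (hπcFeas : Feasible c b πc)
    (hopt : ∀ π : S → A → ℝ, IsPolicy π → Feasible c b π → J R π ≤ J R πc) :
    ∀ π : S → A → ℝ, IsPolicy π →
      J (fun s a => if c s a ≤ b then R s a else 0) π ≤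
        J (fun s a => if c s a ≤ b then R s a else 0) πc := by
  intro π hπ
  choose f hf using hfeas
  obtain ⟨h0, h1⟩ := hπ
  have hm : ∀ s, 0 ≤ ∑ a', (if c s a' ≤ b then 0 else π s a') := fun s =>
    Finset.sum_nonneg fun a _ => by
      split_ifs
      · exact le_rfl
      · exact h0 s a
  -- move the mass on forbidden actions to the allowed action `f s`
  let π' : S → A → ℝ := fun s a => (if c s a ≤ b then π s a else 0) +
    (if a = f s then ∑ a', (if c s a' ≤ b then 0 else π s a') else 0)
  have hp : IsPolicy π' := by
    refine ⟨fun s a => ?_, fun s => ?_⟩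
    · have h2 := h0 s a
      have h3 := hm s
      apply add_nonneg
      · split_ifs
        · exact h2
        · exact le_rfl
      · split_ifs
        · exact h3
        · exact le_rfl
    · simp only [π']
      rw [Finset.sum_add_distrib, Finset.sum_ite_eq' Finset.univ (f s), if_pos (Finset.mem_univ _),
        ← Finset.sum_add_distrib, ← h1 s]
      refine Finset.sum_congr rfl fun a _ => ?_
      split_ifs <;> simp
  have hF : Feasible c b π' := by
    intro s a h
    by_contra hc
    have hne : a ≠ f s := fun h => hc (h ▸ hf s)
    simp [π', hc, hne] at h
  have key := hopt π' hp hF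
  have e : J (fun s a => if c s a ≤ b then R s a else 0) πc = J R πc := by
    refine Finset.sum_congr rfl fun s _ => Finset.sum_congr rfl fun a _ => ?_
    by_cases hc : c s a ≤ b
    · simp [hc]
    · have hz : πc s a = 0 :=
        le_antisymm (not_lt.mp fun h => hc (hπcFeas s a h)) (hπc.1 s a)
      simp [hz]
  rw [e]
  refine le_trans ?_ key
  refine Finset.sum_le_sum fun s _ => Finset.sum_le_sum fun a _ => ?_
  have h4 : 0 ≤ (if a = f s then ∑ a', (if c s a' ≤ b then 0 else π s a') else 0) := by
    have h3 := hm s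
    split_ifs
    · exact h3
    · exact le_rfl
  by_cases hc : c s a ≤ b
  · simp only [π', hc, if_true]
    exact mul_le_mul_of_nonneg_right (le_add_of_nonneg_right h4) (hR s a)
  · simp only [hc, if_false, mul_zero]
    exact mul_nonneg (hp.1 s a) (hR s a)
end

section
/- (Proposition 1.) Suppose R s a ≥ 0 for all s, a; for each state s there exists an action a with c s a ≤ b; and there exists a state s₀ such that the highest-reward actions at s₀ all violate the constraint, i.e. max_{a ∈ A} R s₀ a > max_{a : c s₀ a ≤ b} R s₀ a, and moreover max_{a : c s₀ a ≤ b} R s₀ a > 0. Let π* be a policy maximizing J(R, ·) over all policies (the unconstrained optimum), and let π_c be a feasible policy maximizing J(R, ·) over all feasible policies (the CMDP optimum). Then J(R, π_c) < J(R, π*) and J(R_c, π*) < J(R_c, π_c); consequently, the pair of reward functions (R, R_c) is hackable relative to the set of all policies, witnessed by π := π_c and π' := π*. That is, solving the constrained MDP has an equivalent outcome to hacking the proxy reward function R. -/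
open Finset
open scoped Classical

lemma J_update {S A : Type*} [Fintype S] [Fintype A] (R π : S → A → ℝ) (s₀ : S) (p : A → ℝ) :
    J R (Function.update π s₀ p) = J R π - ∑ a, π s₀ a * R s₀ a + ∑ a, p a * R s₀ a := by
  unfold J
  rw [← Finset.add_sum_erase _ _ (Finset.mem_univ s₀),
    ← Finset.add_sum_erase (a := s₀) _ (fun s => ∑ a, π s a * R s a) (Finset.mem_univ s₀)]
  have h : ∑ s ∈ Finset.univ.erase s₀, ∑ a, Function.update π s₀ p s a * R s a
      = ∑ s ∈ Finset.univ.erase s₀, ∑ a, π s a * R s a := by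
    apply Finset.sum_congr rfl
    intro s hs
    rw [Function.update_of_ne (Finset.ne_of_mem_erase hs)]
  rw [h, Function.update_self]
  ring

lemma isPolicy_update_pure {S A : Type*} [Fintype A] (π : S → A → ℝ) (hπ : IsPolicy π)
    (s₀ : S) (a₀ : A) :
    IsPolicy (Function.update π s₀ (fun a => if a = a₀ then (1 : ℝ) else 0)) := by
  constructor
  · intro s a
    by_cases h : s = s₀
    · subst h
      rw [Function.update_self]
      split_ifs <;> norm_num
    · rw [Function.update_of_ne h]
      exact hπ.1 s a
  · intro s
    by_cases h : s = s₀
    · subst h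
      rw [Function.update_self]
      simp
    · rw [Function.update_of_ne h]
      exact hπ.2 s

/-- Proposition 1: under the hypotheses, `J R π_c < J R π*` and
`J R_c π* < J R_c π_c`, so the pair `(R, R_c)` is hackable relative to all policies,
witnessed by `π := π_c` and `π' := π*`. -/
theorem cmdp_reward_hacking
    {S A : Type*} [Fintype S] [Fintype A] [Nonempty S] [Nonempty A]
    (R c : S → A → ℝ) (b : ℝ)
    (hR : ∀ s a, 0 ≤ R s a)
    (hfeas : ∀ s, ∃ a, c s a ≤ b)
    (s₀ : S)
    (hgap : (Finset.univ.filter (fun a => c s₀ a ≤ b)).sup'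
        (by obtain ⟨a, ha⟩ := hfeas s₀
            exact ⟨a, by simpa using ha⟩) (R s₀)
      < Finset.univ.sup' Finset.univ_nonempty (R s₀))
    (hpos : 0 < (Finset.univ.filter (fun a => c s₀ a ≤ b)).sup'
        (by obtain ⟨a, ha⟩ := hfeas s₀
            exact ⟨a, by simpa using ha⟩) (R s₀))
    (πstar : S → A → ℝ)
    (hπstar : IsPolicy πstar)
    (hoptstar : ∀ π : S → A → ℝ, IsPolicy π → J R π ≤ J R πstar)
    (πc : S → A → ℝ)
    (hπc : IsPolicy πc) (hπcFeas : Feasible c b πc)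
    (hoptc : ∀ π : S → A → ℝ, IsPolicy π → Feasible c b π → J R π ≤ J R πc) :
    (J R πc < J R πstar ∧
      J (fun s a => if c s a ≤ b then R s a else 0) πstar <
        J (fun s a => if c s a ≤ b then R s a else 0) πc) ∧
    ∃ π π' : S → A → ℝ, IsPolicy π ∧ IsPolicy π' ∧
      J R π < J R π' ∧
      J (fun s a => if c s a ≤ b then R s a else 0) π >
        J (fun s a => if c s a ≤ b then R s a else 0) π' := by
  obtain ⟨as, -, has⟩ := Finset.exists_mem_eq_sup' Finset.univ_nonempty (R s₀)
  have hmax : ∀ a, R s₀ a ≤ R s₀ as := fun a => by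
    rw [← has]
    exact Finset.le_sup' (R s₀) (Finset.mem_univ a)
  have hbest : ∀ s, ∃ g, c s g ≤ b ∧ ∀ a, c s a ≤ b → R s a ≤ R s g := by
    intro s
    obtain ⟨a, ha⟩ := hfeas s
    obtain ⟨g, hg, hg'⟩ := Finset.exists_max_image
      (Finset.univ.filter (fun a => c s a ≤ b)) (R s) ⟨a, by simpa using ha⟩
    exact ⟨g, by simpa using hg, fun a ha => hg' a (by simpa using ha)⟩
  choose g hg hgmax using hbest
  have hsup : ∀ h, (Finset.univ.filter (fun a => c s₀ a ≤ b)).sup' h (R s₀) = R s₀ (g s₀) := by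
    intro h
    apply le_antisymm
    · exact Finset.sup'_le _ _ (fun a ha => hgmax s₀ a (by simpa using ha))
    · exact Finset.le_sup' (R s₀) (by simpa using hg s₀)
  rw [hsup, has] at hgap
  rw [hsup] at hpos
  -- a convex combination of the constrained reward is at most the best feasible reward
  have hle : ∀ π : S → A → ℝ, IsPolicy π → ∀ s,
      ∑ a, π s a * (if c s a ≤ b then R s a else 0) ≤ R s (g s) := by
    intro π hπ s
    calc ∑ a, π s a * (if c s a ≤ b then R s a else 0)
        ≤ ∑ a, π s a * R s (g s) := by
          apply Finset.sum_le_sum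
          intro a _
          apply mul_le_mul_of_nonneg_left _ (hπ.1 s a)
          split_ifs with h
          · exact hgmax s a h
          · exact hR _ _
      _ = R s (g s) := by rw [← Finset.sum_mul, hπ.2 s, one_mul]
  have hcterm : ∀ s a, πc s a * (if c s a ≤ b then R s a else 0) = πc s a * R s a := by
    intro s a
    split_ifs with h
    · rfl
    · have : πc s a = 0 :=
        le_antisymm (not_lt.1 fun h' => h (hπcFeas s a h')) (hπc.1 s a)
      rw [this]; simp
  have h1 : J R πc < J R πstar := by
    have h := hoptstar _ (isPolicy_update_pure πc hπc s₀ as)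
    rw [J_update] at h
    have h2 := hle πc hπc s₀
    simp only [hcterm] at h2
    simp only [ite_mul, one_mul, zero_mul, Finset.sum_ite_eq', Finset.mem_univ, if_true] at h
    linarith
  have hzero : ∀ a, πstar s₀ a * (R s₀ as - R s₀ a) = 0 := by
    have h := hoptstar _ (isPolicy_update_pure πstar hπstar s₀ as)
    rw [J_update] at h
    simp only [ite_mul, one_mul, zero_mul, Finset.sum_ite_eq', Finset.mem_univ, if_true] at h
    have hnn : ∀ a ∈ Finset.univ, 0 ≤ πstar s₀ a * (R s₀ as - R s₀ a) := fun a _ =>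
      mul_nonneg (hπstar.1 s₀ a) (sub_nonneg.2 (hmax a))
    have hs : ∑ a, πstar s₀ a * (R s₀ as - R s₀ a) = 0 := by
      apply le_antisymm _ (Finset.sum_nonneg hnn)
      simp only [mul_sub, Finset.sum_sub_distrib]
      rw [← Finset.sum_mul, hπstar.2 s₀]
      linarith
    intro a
    exact (Finset.sum_eq_zero_iff_of_nonneg hnn).1 hs a (Finset.mem_univ a)
  have hs0 : ∑ a, πstar s₀ a * (if c s₀ a ≤ b then R s₀ a else 0) = 0 := by
    apply Finset.sum_eq_zero
    intro a _
    split_ifs with h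
    · rcases mul_eq_zero.1 (hzero a) with h' | h'
      · rw [h', zero_mul]
      · have := hgmax s₀ a h
        linarith
    · simp
  have h2 : J (fun s a => if c s a ≤ b then R s a else 0) πstar <
      J (fun s a => if c s a ≤ b then R s a else 0) πc := by
    have hpol : IsPolicy (fun s a => if a = g s then (1 : ℝ) else 0) := by
      constructor
      · intro s a
        dsimp only
        split_ifs <;> norm_num
      · intro s
        simp
    have hf : Feasible c b (fun s a => if a = g s then (1 : ℝ) else 0) := by
      intro s a h
      by_cases h' : a = g s
      · rw [h']; exact hg s
      · simp [h'] at h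
    have h := hoptc _ hpol hf
    have hc : J (fun s a => if c s a ≤ b then R s a else 0) πc = J R πc := by
      simp only [J, hcterm]
    rw [hc]
    refine lt_of_lt_of_le ?_ h
    simp only [J, ite_mul, one_mul, zero_mul, Finset.sum_ite_eq', Finset.mem_univ, if_true]
    apply Finset.sum_lt_sum (fun s _ => hle πstar hπstar s)
    exact ⟨s₀, Finset.mem_univ _, by rw [hs0]; exact hpos⟩
  exact ⟨⟨h1, h2⟩, πc, πstar, hπc, hπstar, h1, h2⟩
end
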